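/- Fix q ∈ (0,1) and a number of samples n ≥ 1. The supremum, over all probability distributions F on [0,∞) with finite mean, of the expected multiplicative regret (E[L(â)] − L(a*))/L(a*) of the SAA decision â based on n IID samples, equals max{ sup_{p ∈ (0,q)} ((q−p)/((1−q)·p))·Pr[(1/n)·Bin(n,p) ≥ q], sup_{p ∈ [q,1)} ((p−q)/(q·(1−p)))·Pr[(1/n)·Bin(n,p) < q] }, where Bin(n,p) denotes a binomial random variable with n trials and success probability p; moreover this supremum is attained in the limit over Bernoulli demand distributions. -/

import Mathlib

open MeasureTheory Set

noncomputable section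

/-- The Newsvendor loss `ℓ(a,Z) = q·max{Z−a,0} + (1−q)·max{a−Z,0}` with critical quantile `q`. -/
def nvLoss (q a z : ℝ) : ℝ := q * max (z - a) 0 + (1 - q) * max (a - z) 0

/-- The expected Newsvendor loss `L(a)` under the demand distribution `μ`. -/
def expLoss (q : ℝ) (μ : Measure ℝ) (a : ℝ) : ℝ := ∫ z, nvLoss q a z ∂μ

/-- The CDF of the demand distribution `μ`. -/
def cdf' (μ : Measure ℝ) (z : ℝ) : ℝ := (μ (Iic z)).toReal

/-- The optimal decision `a* = inf {a ≥ 0 : F(a) ≥ q}`. -/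
def optDec (q : ℝ) (μ : Measure ℝ) : ℝ := sInf {a : ℝ | 0 ≤ a ∧ q ≤ cdf' μ a}

/-- The empirical CDF of the samples `ω : Fin n → ℝ`. -/
def empCdf (n : ℕ) (ω : Fin n → ℝ) (z : ℝ) : ℝ :=
  (∑ i : Fin n, if ω i ≤ z then (1 : ℝ) else 0) / n

/-- The SAA (sample average approximation) decision `â = inf {a ≥ 0 : F̂(a) ≥ q}`. -/
def saa (q : ℝ) (n : ℕ) (ω : Fin n → ℝ) : ℝ := sInf {a : ℝ | 0 ≤ a ∧ q ≤ empCdf n ω a}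

/-- The joint law of `n` iid samples from `μ`. -/
def iid (μ : Measure ℝ) (n : ℕ) : Measure (Fin n → ℝ) := Measure.pi fun _ => μ

/-- A distribution `μ` is `(β,γ,ζ)`-clustered if
`|a − a*| ≤ (1/γ)·|F(a) − q|^{1/(β+1)}` for all `a ∈ [a*−ζ, a*+ζ]`. -/
def Clustered (q β γ ζ : ℝ) (μ : Measure ℝ) : Prop :=
  ∀ a ∈ Icc (optDec q μ - ζ) (optDec q μ + ζ),
    |a - optDec q μ| ≤ (1 / γ) * |cdf' μ a - q| ^ ((1 : ℝ) / (β + 1))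

/-- `Pr[(1/n)·Bin(n,p) ≥ q]` for a binomial random variable with parameters `n, p`. -/
def binomPrGe (n : ℕ) (p q : ℝ) : ℝ :=
  ∑ k ∈ Finset.range (n+1),
    if q ≤ (k:ℝ)/n then (n.choose k : ℝ) * p^k * (1-p)^(n-k) else 0

/-- `Pr[(1/n)·Bin(n,p) < q]` for a binomial random variable with parameters `n, p`. -/
def binomPrLt (n : ℕ) (p q : ℝ) : ℝ :=
  ∑ k ∈ Finset.range (n+1),
    if (k:ℝ)/n < q then (n.choose k : ℝ) * p^k * (1-p)^(n-k) else 0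

/-- The Bernoulli demand distribution with mass `p` at `0` and mass `1−p` at `1`. -/
def bernoulliAt0 (p : ℝ) : Measure ℝ :=
  ENNReal.ofReal p • Measure.dirac 0 + ENNReal.ofReal (1-p) • Measure.dirac 1

/-- The expected multiplicative regret of SAA with `n` samples on distribution `μ`. -/
def expMultRegret (q : ℝ) (n : ℕ) (μ : Measure ℝ) : ℝ :=
  ((∫ ω, expLoss q μ (saa q n ω) ∂(iid μ n)) - expLoss q μ (optDec q μ))
    / expLoss q μ (optDec q μ)

section Quantile

/-- For a monotone right-continuous function, the generalized inverse satisfies a Galois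
connection. -/
lemma sInf_superlevel_le_iff {f : ℝ → ℝ} {q t : ℝ} (hf : Monotone f)
    (hc : ∀ x, ContinuousWithinAt f (Ici x) x) (hne : ∃ a, q ≤ f a) (ht : 0 ≤ t) :
    sInf {a : ℝ | 0 ≤ a ∧ q ≤ f a} ≤ t ↔ q ≤ f t := by
  have hbdd : BddBelow {a : ℝ | 0 ≤ a ∧ q ≤ f a} := ⟨0, fun a ha => ha.1⟩
  refine ⟨fun h => ?_, fun h => csInf_le hbdd ⟨ht, h⟩⟩
  obtain ⟨b, hb⟩ := hne
  have hne' : {a : ℝ | 0 ≤ a ∧ q ≤ f a}.Nonempty :=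
    ⟨max b 0, le_max_right _ _, hb.trans (hf (le_max_left _ _))⟩
  have hgt : ∀ x, t < x → q ≤ f x := fun x hx => by
    obtain ⟨a, ha, hax⟩ := exists_lt_of_csInf_lt hne' (h.trans_lt hx)
    exact ha.2.trans (hf hax.le)
  have hlim : Filter.Tendsto f (nhdsWithin t (Ioi t)) (nhds (f t)) :=
    (hc t).mono Ioi_subset_Ici_self
  exact ge_of_tendsto hlim (Filter.eventually_of_mem self_mem_nhdsWithin hgt)

lemma sInf_superlevel_nonneg (f : ℝ → ℝ) (q : ℝ) : 0 ≤ sInf {a : ℝ | 0 ≤ a ∧ q ≤ f a} :=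
  Real.sInf_nonneg fun _ ha => ha.1

lemma cdf'_eq_cdf (μ : Measure ℝ) [IsProbabilityMeasure μ] : cdf' μ = ProbabilityTheory.cdf μ := by
  ext z
  rw [ProbabilityTheory.cdf_eq_real]
  rfl

lemma optDec_le_iff {q : ℝ} (hq : q < 1) (μ : Measure ℝ) [IsProbabilityMeasure μ] {t : ℝ}
    (ht : 0 ≤ t) : optDec q μ ≤ t ↔ q ≤ cdf' μ t := by
  unfold optDec
  rw [cdf'_eq_cdf]
  refine sInf_superlevel_le_iff (ProbabilityTheory.monotone_cdf μ)
    (fun x => (ProbabilityTheory.cdf μ).right_continuous x) ?_ ht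
  exact (((ProbabilityTheory.tendsto_cdf_atTop μ).eventually (lt_mem_nhds hq)).exists).imp
    fun _ h => h.le

lemma empCdf_mono (n : ℕ) (ω : Fin n → ℝ) : Monotone (empCdf n ω) := by
  intro x y hxy
  unfold empCdf
  gcongr with i
  split_ifs with h1 h2
  · rfl
  · exact absurd (h1.trans hxy) h2
  · exact zero_le_one
  · rfl

lemma empCdf_right_continuous (n : ℕ) (ω : Fin n → ℝ) (x : ℝ) :
    ContinuousWithinAt (empCdf n ω) (Ici x) x := by
  refine ContinuousWithinAt.div_const (tendsto_finsetSum _ fun i _ => ?_) _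
  refine tendsto_const_nhds.congr' ?_
  by_cases h : ω i ≤ x
  · filter_upwards [self_mem_nhdsWithin] with y hy
    rw [if_pos h, if_pos (h.trans hy)]
  · filter_upwards [mem_nhdsWithin_of_mem_nhds (gt_mem_nhds (not_le.1 h))] with y hy
    rw [if_neg h, if_neg (not_le.2 hy)]

lemma saa_le_iff {q : ℝ} (hq : q < 1) {n : ℕ} (hn : 1 ≤ n) (ω : Fin n → ℝ) {t : ℝ}
    (ht : 0 ≤ t) : saa q n ω ≤ t ↔ q ≤ empCdf n ω t := by
  refine sInf_superlevel_le_iff (empCdf_mono n ω) (empCdf_right_continuous n ω) ?_ ht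
  obtain ⟨b, hb⟩ := (Set.finite_range ω).bddAbove
  refine ⟨b, ?_⟩
  have h : ∀ i, ω i ≤ b := fun i => hb ⟨i, rfl⟩
  have : (n : ℝ) ≠ 0 := by positivity
  simp [empCdf, h, this, hq.le]

lemma measurable_empCdf (n : ℕ) (t : ℝ) : Measurable fun ω : Fin n → ℝ => empCdf n ω t := by
  unfold empCdf
  refine (Finset.measurable_sum _ fun i _ => ?_).div_const _
  exact Measurable.ite (measurableSet_le (measurable_pi_apply i) measurable_const)
    measurable_const measurable_const

lemma measurable_saa {q : ℝ} (hq : q < 1) {n : ℕ} (hn : 1 ≤ n) : Measurable (saa q n) := by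
  refine measurable_of_Iic fun t => ?_
  rcases lt_or_ge t 0 with ht | ht
  · convert MeasurableSet.empty
    ext ω
    exact iff_of_false (not_le.2 (ht.trans_le (sInf_superlevel_nonneg (empCdf n ω) q))) id
  · have : saa q n ⁻¹' Iic t = {ω | q ≤ empCdf n ω t} := by
      ext ω
      exact saa_le_iff hq hn ω ht
    rw [this]
    exact measurableSet_le measurable_const (measurable_empCdf n t)

end Quantile

section Binomial

lemma binomPrGe_eq (n : ℕ) (p q : ℝ) : binomPrGe n p q =
    ∑ k ∈ Finset.range (n + 1), (n.choose k) •
      (if q ≤ (k : ℝ) / n then p ^ k * (1 - p) ^ (n - k) else 0) := by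
  unfold binomPrGe
  refine Finset.sum_congr rfl fun k _ => ?_
  split_ifs <;> simp [mul_assoc]

lemma binomPrGe_add_binomPrLt (n : ℕ) (p q : ℝ) : binomPrGe n p q + binomPrLt n p q = 1 := by
  have h := add_pow p (1 - p) n
  rw [add_sub_cancel, one_pow] at h
  rw [h, binomPrGe, binomPrLt, ← Finset.sum_add_distrib]
  refine Finset.sum_congr rfl fun k _ => ?_
  by_cases hk : q ≤ (k : ℝ) / n
  · rw [if_pos hk, if_neg (not_lt.2 hk)]
    ring
  · rw [if_neg hk, if_pos (not_le.1 hk)]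
    ring

lemma binomPrGe_nonneg (n : ℕ) {p : ℝ} (q : ℝ) (hp : p ∈ Icc (0 : ℝ) 1) :
    0 ≤ binomPrGe n p q := by
  have := hp.1
  have := sub_nonneg.2 hp.2
  exact Finset.sum_nonneg fun k _ => by split_ifs <;> positivity

lemma binomPrLt_nonneg (n : ℕ) {p : ℝ} (q : ℝ) (hp : p ∈ Icc (0 : ℝ) 1) :
    0 ≤ binomPrLt n p q := by
  have := hp.1
  have := sub_nonneg.2 hp.2
  exact Finset.sum_nonneg fun k _ => by split_ifs <;> positivity

lemma binomPrGe_le {q : ℝ} (hq : 0 < q) (n : ℕ) {p : ℝ} (hp : p ∈ Icc (0 : ℝ) 1) :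
    binomPrGe n p q ≤ 2 ^ n * p := by
  have h0 := hp.1
  have h1 := sub_nonneg.2 hp.2
  have h2 : 1 - p ≤ 1 := by linarith
  have hs : ((2 : ℝ) ^ n) = ∑ k ∈ Finset.range (n + 1), (n.choose k : ℝ) := by
    exact_mod_cast (Nat.sum_range_choose n).symm
  rw [hs, Finset.sum_mul]
  refine Finset.sum_le_sum fun k _ => ?_
  split_ifs with hk
  · have hk0 : k ≠ 0 := by
      rintro rfl
      simp at hk
      linarith
    have : p ^ k * (1 - p) ^ (n - k) ≤ p * 1 :=
      mul_le_mul (pow_le_of_le_one h0 hp.2 hk0) (pow_le_one₀ h1 h2) (by positivity) h0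
    rw [mul_assoc]
    gcongr
    simpa using this
  · positivity

lemma binomPrLt_le {q : ℝ} (hq : q < 1) {n : ℕ} (hn : 1 ≤ n) {p : ℝ} (hp : p ∈ Icc (0 : ℝ) 1) :
    binomPrLt n p q ≤ 2 ^ n * (1 - p) := by
  have h0 := hp.1
  have h1 := sub_nonneg.2 hp.2
  have h2 : 1 - p ≤ 1 := by linarith
  have hs : ((2 : ℝ) ^ n) = ∑ k ∈ Finset.range (n + 1), (n.choose k : ℝ) := by
    exact_mod_cast (Nat.sum_range_choose n).symm
  rw [hs, Finset.sum_mul]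
  refine Finset.sum_le_sum fun k hkn => ?_
  split_ifs with hk
  · have hn0 : (0 : ℝ) < n := by exact_mod_cast hn
    have hlt : k < n := by
      rw [div_lt_iff₀ hn0] at hk
      have : (k : ℝ) < n := by nlinarith
      exact_mod_cast this
    have : p ^ k * (1 - p) ^ (n - k) ≤ 1 * (1 - p) :=
      mul_le_mul (pow_le_one₀ h0 hp.2) (pow_le_of_le_one h1 h2 (by omega)) (by positivity)
        zero_le_one
    rw [mul_assoc]
    gcongr
    simpa using this
  · positivity

instance (μ : Measure ℝ) [IsProbabilityMeasure μ] (n : ℕ) : IsProbabilityMeasure (iid μ n) := by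
  unfold iid
  infer_instance

lemma iid_real_le_pattern (μ : Measure ℝ) [IsProbabilityMeasure μ] (n : ℕ) (t : ℝ)
    (S : Finset (Fin n)) :
    (iid μ n).real {ω | Finset.univ.filter (fun i => ω i ≤ t) = S} =
      cdf' μ t ^ S.card * (1 - cdf' μ t) ^ (n - S.card) := by
  have hset : {ω : Fin n → ℝ | Finset.univ.filter (fun i => ω i ≤ t) = S} =
      Set.univ.pi fun i => if i ∈ S then Iic t else Ioi t := by
    ext ω
    simp only [Finset.ext_iff, Finset.mem_filter, Finset.mem_univ, true_and, mem_ofPred_eq,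
      mem_univ_pi]
    refine forall_congr' fun i => ?_
    by_cases hi : i ∈ S <;> simp [hi]
  have hIoi : μ.real (Ioi t) = 1 - cdf' μ t := by
    rw [← compl_Iic, probReal_compl_eq_one_sub measurableSet_Iic]
    rfl
  have hval : ∀ i : Fin n, (μ (if i ∈ S then Iic t else Ioi t)).toReal =
      if i ∈ S then cdf' μ t else 1 - cdf' μ t := by
    intro i
    split_ifs
    · rfl
    · exact hIoi
  rw [hset, Measure.real, iid, Measure.pi_pi, ENNReal.toReal_prod]
  simp_rw [hval]
  rw [Finset.prod_ite]
  simp [Finset.filter_not, Finset.card_sdiff]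

lemma empCdf_eq_card (n : ℕ) (ω : Fin n → ℝ) (t : ℝ) :
    empCdf n ω t = ((Finset.univ.filter fun i => ω i ≤ t).card : ℝ) / n := by
  simp [empCdf]

lemma iid_real_le_empCdf (μ : Measure ℝ) [IsProbabilityMeasure μ] (n : ℕ) (q t : ℝ) :
    (iid μ n).real {ω | q ≤ empCdf n ω t} = binomPrGe n (cdf' μ t) q := by
  classical
  have hset : {ω : Fin n → ℝ | q ≤ empCdf n ω t} =
      ⋃ S ∈ Finset.univ.powerset.filter (fun S : Finset (Fin n) => q ≤ (S.card : ℝ) / n),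
        {ω | Finset.univ.filter (fun i => ω i ≤ t) = S} := by
    ext ω
    simp [empCdf_eq_card]
  have hmeas : ∀ S : Finset (Fin n),
      MeasurableSet {ω : Fin n → ℝ | Finset.univ.filter (fun i => ω i ≤ t) = S} := by
    intro S
    simp only [Finset.ext_iff, Finset.mem_filter, Finset.mem_univ, true_and]
    refine measurableSet_setOfPred.2 (Measurable.forall fun i => measurableSet_setOfPred.1 ?_)
    by_cases hi : i ∈ S
    · simpa [hi] using measurableSet_le (measurable_pi_apply i) measurable_const
    · simpa [hi] using measurableSet_lt measurable_const (measurable_pi_apply i)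
  rw [hset, measureReal_biUnion_finset ?_ fun S _ => hmeas S]
  · simp_rw [iid_real_le_pattern]
    rw [Finset.sum_filter, Finset.sum_powerset_apply_card
      (fun k => if q ≤ (k : ℝ) / n then cdf' μ t ^ k * (1 - cdf' μ t) ^ (n - k) else 0),
      Finset.card_univ, Fintype.card_fin, binomPrGe_eq]
  · intro S _ T _ hST
    refine Set.disjoint_left.2 fun ω hS hT => hST ?_
    exact Eq.trans (Eq.symm hS) hT

end Binomial

section Loss

/-- The cost rate of the decision `a` at level `t`; its integral over `t ≥ 0` is `L(a)`. -/
def lossDensity (q : ℝ) (μ : Measure ℝ) (a t : ℝ) : ℝ :=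
  if t < a then (1 - q) * cdf' μ t else q * (1 - cdf' μ t)

/-- The expected cost rate of the SAA decision at a level whose CDF value is `p`. -/
def saaDensity (q : ℝ) (n : ℕ) (p : ℝ) : ℝ :=
  (1 - q) * p * binomPrLt n p q + q * (1 - p) * binomPrGe n p q

lemma cdf'_mem_Icc (μ : Measure ℝ) [IsProbabilityMeasure μ] (t : ℝ) :
    cdf' μ t ∈ Icc (0 : ℝ) 1 :=
  ⟨measureReal_nonneg, measureReal_le_one⟩

lemma nvLoss_nonneg {q : ℝ} (hq : q ∈ Ioo (0 : ℝ) 1) (a z : ℝ) : 0 ≤ nvLoss q a z := by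
  have h0 := hq.1.le
  have h1 := sub_nonneg.2 hq.2.le
  unfold nvLoss
  positivity

lemma expLoss_nonneg {q : ℝ} (hq : q ∈ Ioo (0 : ℝ) 1) (μ : Measure ℝ) (a : ℝ) :
    0 ≤ expLoss q μ a :=
  integral_nonneg fun z => nvLoss_nonneg hq a z

lemma integrable_nvLoss (q a : ℝ) {μ : Measure ℝ} [IsProbabilityMeasure μ]
    (hi : Integrable (fun z => z) μ) : Integrable (nvLoss q a) μ := by
  have h1 : Integrable (fun z => max (z - a) 0) μ := (hi.sub (integrable_const a)).pos_part
  have h2 : Integrable (fun z => max (a - z) 0) μ := ((integrable_const a).sub hi).pos_part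
  exact (h1.const_mul q).add (h2.const_mul (1 - q))

lemma lossDensity_nonneg {q : ℝ} (hq : q ∈ Ioo (0 : ℝ) 1) (μ : Measure ℝ)
    [IsProbabilityMeasure μ] (a t : ℝ) : 0 ≤ lossDensity q μ a t := by
  have h0 := hq.1.le
  have h1 := sub_nonneg.2 hq.2.le
  have h2 := (cdf'_mem_Icc μ t).1
  have h3 := sub_nonneg.2 (cdf'_mem_Icc μ t).2
  unfold lossDensity
  split_ifs <;> positivity

lemma saaDensity_nonneg {q : ℝ} (hq : q ∈ Ioo (0 : ℝ) 1) (n : ℕ) {p : ℝ}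
    (hp : p ∈ Icc (0 : ℝ) 1) : 0 ≤ saaDensity q n p := by
  have h0 := hq.1.le
  have h1 := sub_nonneg.2 hq.2.le
  have h2 := hp.1
  have h3 := sub_nonneg.2 hp.2
  have h4 := binomPrGe_nonneg n q hp
  have h5 := binomPrLt_nonneg n q hp
  unfold saaDensity
  positivity

lemma measurable_cdf' (μ : Measure ℝ) [IsProbabilityMeasure μ] : Measurable (cdf' μ) := by
  rw [cdf'_eq_cdf]
  exact (ProbabilityTheory.monotone_cdf μ).measurable

/-- Layer-cake representation of the Newsvendor loss. -/
lemma ofReal_nvLoss {q : ℝ} (hq : q ∈ Ioo (0 : ℝ) 1) {a z : ℝ} (ha : 0 ≤ a) (hz : 0 ≤ z) :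
    ENNReal.ofReal (nvLoss q a z) = ∫⁻ t in Ici (0 : ℝ), ENNReal.ofReal
      (if t < a then (1 - q) * (if z ≤ t then 1 else 0) else q * (if z ≤ t then 0 else 1)) := by
  have h0 := hq.1.le
  have h1 := sub_nonneg.2 hq.2.le
  have hfun : ∀ t : ℝ, ENNReal.ofReal
      (if t < a then (1 - q) * (if z ≤ t then 1 else 0) else q * (if z ≤ t then 0 else 1)) =
      (Ico a z).indicator (fun _ => ENNReal.ofReal q) t +
        (Ico z a).indicator (fun _ => ENNReal.ofReal (1 - q)) t := by
    intro t
    by_cases hta : t < a <;> by_cases hzt : z ≤ t <;>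
      simp [Set.indicator, hta, hzt, not_le.2, not_lt.2, not_lt.1, not_le.1]
  simp_rw [hfun]
  rw [lintegral_add_left (measurable_const.indicator measurableSet_Ico),
    lintegral_indicator measurableSet_Ico, lintegral_indicator measurableSet_Ico,
    Measure.restrict_restrict measurableSet_Ico, Measure.restrict_restrict measurableSet_Ico,
    inter_eq_left.2 (Ico_subset_Ici_self.trans (Ici_subset_Ici.2 ha)),
    inter_eq_left.2 (Ico_subset_Ici_self.trans (Ici_subset_Ici.2 hz))]
  simp only [setLIntegral_const, Real.volume_Ico]
  rw [← ENNReal.ofReal_mul h0, ← ENNReal.ofReal_mul h1, nvLoss,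
    ENNReal.ofReal_add (by positivity) (by positivity)]
  simp only [ENNReal.ofReal_mul h0, ENNReal.ofReal_mul h1, ENNReal.ofReal_max,
    ENNReal.ofReal_zero]
  simp

lemma ofReal_expLoss {q : ℝ} (hq : q ∈ Ioo (0 : ℝ) 1) {μ : Measure ℝ} [IsProbabilityMeasure μ]
    (hμ : μ (Iio 0) = 0) (hi : Integrable (fun z => z) μ) {a : ℝ} (ha : 0 ≤ a) :
    ENNReal.ofReal (expLoss q μ a) =
      ∫⁻ t in Ici (0 : ℝ), ENNReal.ofReal (lossDensity q μ a t) := by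
  have h0 := hq.1.le
  have h1 := sub_nonneg.2 hq.2.le
  have hae : ∀ᵐ z ∂μ, 0 ≤ z := by
    simp_rw [ae_iff, not_le]
    exact hμ
  rw [expLoss, ofReal_integral_eq_lintegral_ofReal (integrable_nvLoss q a hi)
    (Filter.Eventually.of_forall fun z => nvLoss_nonneg hq a z),
    lintegral_congr_ae (hae.mono fun z hz => ofReal_nvLoss hq ha hz), lintegral_lintegral_swap]
  · refine lintegral_congr fun t => ?_
    have hIoi : μ.real (Ioi t) = 1 - cdf' μ t := by
      rw [← compl_Iic, probReal_compl_eq_one_sub measurableSet_Iic]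
      rfl
    unfold lossDensity
    split_ifs with hta
    · have : ∀ z : ℝ, ENNReal.ofReal ((1 - q) * (if z ≤ t then 1 else 0)) =
          (Iic t).indicator (fun _ => ENNReal.ofReal (1 - q)) z := fun z => by
        by_cases hz : z ≤ t <;> simp [hz]
      simp_rw [this]
      rw [lintegral_indicator_const measurableSet_Iic, ENNReal.ofReal_mul h1, cdf',
        ENNReal.ofReal_toReal (measure_ne_top _ _)]
    · have : ∀ z : ℝ, ENNReal.ofReal (q * (if z ≤ t then 0 else 1)) =
          (Ioi t).indicator (fun _ => ENNReal.ofReal q) z := fun z => by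
        by_cases hz : z ≤ t <;> simp [hz, not_lt.2, not_le.1]
      simp_rw [this]
      rw [lintegral_indicator_const measurableSet_Ioi, ENNReal.ofReal_mul h0, ← hIoi,
        ofReal_measureReal]
  · have hle : MeasurableSet {x : ℝ × ℝ | x.1 ≤ x.2} := measurableSet_le measurable_fst measurable_snd
    refine (Measurable.ennreal_ofReal ?_).aemeasurable
    refine Measurable.ite (measurableSet_lt measurable_snd measurable_const) ?_ ?_
    · exact (Measurable.ite hle measurable_const measurable_const).const_mul _
    · exact (Measurable.ite hle measurable_const measurable_const).const_mul _

lemma lintegral_lossDensity_saa {q : ℝ} (hq : q ∈ Ioo (0 : ℝ) 1) {n : ℕ} (hn : 1 ≤ n)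
    (μ : Measure ℝ) [IsProbabilityMeasure μ] {t : ℝ} (ht : 0 ≤ t) :
    ∫⁻ ω, ENNReal.ofReal (lossDensity q μ (saa q n ω) t) ∂(iid μ n) =
      ENNReal.ofReal (saaDensity q n (cdf' μ t)) := by
  have h0 := hq.1.le
  have h1 := sub_nonneg.2 hq.2.le
  have h2 := (cdf'_mem_Icc μ t).1
  have h3 := sub_nonneg.2 (cdf'_mem_Icc μ t).2
  have h4 := binomPrGe_nonneg n q (cdf'_mem_Icc μ t)
  have h5 := binomPrLt_nonneg n q (cdf'_mem_Icc μ t)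
  set E : Set (Fin n → ℝ) := {ω | q ≤ empCdf n ω t} with hE
  have hEm : MeasurableSet E := measurableSet_le measurable_const (measurable_empCdf n t)
  have hfun : ∀ ω, ENNReal.ofReal (lossDensity q μ (saa q n ω) t) =
      Eᶜ.indicator (fun _ => ENNReal.ofReal ((1 - q) * cdf' μ t)) ω +
        E.indicator (fun _ => ENNReal.ofReal (q * (1 - cdf' μ t))) ω := by
    intro ω
    have hiff := saa_le_iff hq.2 hn ω ht
    by_cases hω : ω ∈ E
    · simp [lossDensity, hω, not_lt.2 (hiff.2 hω)]
    · have : t < saa q n ω := not_le.1 fun h => hω (hiff.1 h)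
      simp [lossDensity, hω, this]
  have hPE : (iid μ n).real E = binomPrGe n (cdf' μ t) q := iid_real_le_empCdf μ n q t
  have hPEc : (iid μ n).real Eᶜ = binomPrLt n (cdf' μ t) q := by
    rw [probReal_compl_eq_one_sub hEm, hPE]
    linarith [binomPrGe_add_binomPrLt n (cdf' μ t) q]
  simp_rw [hfun]
  rw [lintegral_add_left (measurable_const.indicator hEm.compl),
    lintegral_indicator_const hEm.compl, lintegral_indicator_const hEm,
    ← ofReal_measureReal (s := E), ← ofReal_measureReal (s := Eᶜ), hPE, hPEc,
    ← ENNReal.ofReal_mul (by positivity), ← ENNReal.ofReal_mul (by positivity),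
    ← ENNReal.ofReal_add (by positivity) (by positivity), saaDensity]

lemma lintegral_expLoss_saa {q : ℝ} (hq : q ∈ Ioo (0 : ℝ) 1) {n : ℕ} (hn : 1 ≤ n)
    {μ : Measure ℝ} [IsProbabilityMeasure μ] (hμ : μ (Iio 0) = 0)
    (hi : Integrable (fun z => z) μ) :
    ∫⁻ ω, ENNReal.ofReal (expLoss q μ (saa q n ω)) ∂(iid μ n) =
      ∫⁻ t in Ici (0 : ℝ), ENNReal.ofReal (saaDensity q n (cdf' μ t)) := by
  have hnn : ∀ ω, 0 ≤ saa q n ω := fun ω => sInf_superlevel_nonneg (empCdf n ω) q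
  simp_rw [fun ω => ofReal_expLoss hq hμ hi (hnn ω)]
  rw [lintegral_lintegral_swap]
  · exact setLIntegral_congr_fun measurableSet_Ici fun t ht => lintegral_lossDensity_saa hq hn μ ht
  · refine (Measurable.ennreal_ofReal ?_).aemeasurable
    have hc : Measurable fun x : (Fin n → ℝ) × ℝ => cdf' μ x.2 :=
      (measurable_cdf' μ).comp measurable_snd
    exact Measurable.ite
      (measurableSet_lt measurable_snd ((measurable_saa hq.2 hn).comp measurable_fst))
      (hc.const_mul _) ((hc.const_sub _).const_mul _)

lemma integral_expLoss_saa {q : ℝ} (hq : q ∈ Ioo (0 : ℝ) 1) {n : ℕ} (hn : 1 ≤ n)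
    {μ : Measure ℝ} [IsProbabilityMeasure μ] (hμ : μ (Iio 0) = 0)
    (hi : Integrable (fun z => z) μ) :
    ∫ ω, expLoss q μ (saa q n ω) ∂(iid μ n) =
      (∫⁻ t in Ici (0 : ℝ), ENNReal.ofReal (saaDensity q n (cdf' μ t))).toReal := by
  rw [← lintegral_expLoss_saa hq hn hμ hi]
  refine integral_eq_lintegral_of_nonneg_ae
    (Filter.Eventually.of_forall fun ω => expLoss_nonneg hq μ _) ?_
  have hcont : Continuous (Function.uncurry (nvLoss q)) := by
    unfold nvLoss Function.uncurry
    fun_prop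
  have hsm : StronglyMeasurable (expLoss q μ) := hcont.stronglyMeasurable.integral_prod_right
  exact (hsm.comp_measurable (measurable_saa hq.2 hn)).aestronglyMeasurable

lemma optDec_nonneg (q : ℝ) (μ : Measure ℝ) : 0 ≤ optDec q μ := sInf_superlevel_nonneg _ q

lemma expMultRegret_le {q : ℝ} (hq : q ∈ Ioo (0 : ℝ) 1) {n : ℕ} (hn : 1 ≤ n) {C : ℝ}
    (hC : 0 ≤ C)
    (hlow : ∀ p ∈ Ico (0 : ℝ) q, (q - p) * binomPrGe n p q ≤ C * ((1 - q) * p))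
    (hhigh : ∀ p ∈ Icc q (1 : ℝ), (p - q) * binomPrLt n p q ≤ C * (q * (1 - p)))
    {μ : Measure ℝ} [IsProbabilityMeasure μ] (hμ : μ (Iio 0) = 0)
    (hi : Integrable (fun z => z) μ) : expMultRegret q n μ ≤ C := by
  have hpt : ∀ t ∈ Ici (0 : ℝ), saaDensity q n (cdf' μ t) ≤
      (1 + C) * lossDensity q μ (optDec q μ) t := by
    intro t ht
    have hiff := optDec_le_iff hq.2 μ ht
    have hsum := binomPrGe_add_binomPrLt n (cdf' μ t) q
    have hmem := cdf'_mem_Icc μ t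
    unfold saaDensity lossDensity
    split_ifs with h
    · have := hlow _ ⟨hmem.1, not_le.1 fun h' => not_le.2 h (hiff.2 h')⟩
      rw [← eq_sub_iff_add_eq'] at hsum
      rw [hsum]
      linarith
    · have := hhigh _ ⟨hiff.1 (not_lt.1 h), hmem.2⟩
      rw [← eq_sub_iff_add_eq] at hsum
      rw [hsum]
      linarith
  have hbound : ∫ ω, expLoss q μ (saa q n ω) ∂(iid μ n) ≤
      (1 + C) * expLoss q μ (optDec q μ) := by
    rw [integral_expLoss_saa hq hn hμ hi]
    refine ENNReal.toReal_le_of_le_ofReal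
      (mul_nonneg (by positivity) (expLoss_nonneg hq μ _)) ?_
    rw [ENNReal.ofReal_mul (by positivity), ofReal_expLoss hq hμ hi (optDec_nonneg q μ),
      ← lintegral_const_mul' _ _ ENNReal.ofReal_ne_top]
    refine setLIntegral_mono' measurableSet_Ici fun t ht => ?_
    rw [← ENNReal.ofReal_mul (by positivity)]
    exact ENNReal.ofReal_le_ofReal (hpt t ht)
  refine div_le_of_le_mul₀ (expLoss_nonneg hq μ _) hC ?_
  linarith

end Loss

section Bernoulli

variable {p : ℝ}

lemma isProbabilityMeasure_bernoulliAt0 (hp : p ∈ Ioo (0 : ℝ) 1) :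
    IsProbabilityMeasure (bernoulliAt0 p) := by
  constructor
  simp only [bernoulliAt0, Measure.coe_add, Measure.coe_smul, Pi.add_apply, Pi.smul_apply,
    measure_univ, smul_eq_mul, mul_one]
  rw [← ENNReal.ofReal_add hp.1.le (sub_nonneg.2 hp.2.le)]
  simp

lemma bernoulliAt0_Iio (p : ℝ) : bernoulliAt0 p (Iio 0) = 0 := by
  simp [bernoulliAt0, measurableSet_Iio]

lemma integrable_bernoulliAt0 (p : ℝ) (f : ℝ → ℝ) : Integrable f (bernoulliAt0 p) := by
  refine Integrable.add_measure ?_ ?_ <;>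
    exact (integrable_dirac (by simp)).smul_measure ENNReal.ofReal_ne_top

lemma expLoss_bernoulliAt0 (hp : p ∈ Ioo (0 : ℝ) 1) (q a : ℝ) :
    expLoss q (bernoulliAt0 p) a = p * nvLoss q a 0 + (1 - p) * nvLoss q a 1 := by
  have h : ∀ x : ℝ, Integrable (nvLoss q a) (Measure.dirac x) := fun x =>
    integrable_dirac (by simp)
  rw [expLoss, bernoulliAt0, integral_add_measure ((h 0).smul_measure ENNReal.ofReal_ne_top)
    ((h 1).smul_measure ENNReal.ofReal_ne_top), integral_smul_measure, integral_smul_measure,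
    integral_dirac, integral_dirac, ENNReal.toReal_ofReal hp.1.le,
    ENNReal.toReal_ofReal (sub_nonneg.2 hp.2.le), smul_eq_mul, smul_eq_mul]

lemma cdf'_bernoulliAt0 (hp : p ∈ Ioo (0 : ℝ) 1) {t : ℝ} (ht : 0 ≤ t) :
    cdf' (bernoulliAt0 p) t = if t < 1 then p else 1 := by
  have h1 := sub_nonneg.2 hp.2.le
  split_ifs with h
  · simp [cdf', bernoulliAt0, measurableSet_Iic, ht, h, hp.1.le]
  · simp only [cdf', bernoulliAt0, Measure.coe_add, Measure.coe_smul, Pi.add_apply,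
      Pi.smul_apply, smul_eq_mul, Measure.dirac_apply' _ measurableSet_Iic]
    simp only [Set.indicator, mem_Iic, ht, not_lt.1 h, if_true, Pi.one_apply, mul_one]
    rw [← ENNReal.ofReal_add hp.1.le h1]
    simp

lemma integral_expLoss_saa_bernoulliAt0 {q : ℝ} (hq : q ∈ Ioo (0 : ℝ) 1) {n : ℕ} (hn : 1 ≤ n)
    (hp : p ∈ Ioo (0 : ℝ) 1) :
    ∫ ω, expLoss q (bernoulliAt0 p) (saa q n ω) ∂(iid (bernoulliAt0 p) n) =
      saaDensity q n p := by
  have := isProbabilityMeasure_bernoulliAt0 hp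
  have hone : saaDensity q n 1 = 0 := by
    have h1 := binomPrLt_le hq.2 hn (p := 1) (by simp)
    have h2 := binomPrLt_nonneg n q (p := 1) (by simp)
    have : binomPrLt n 1 q = 0 := le_antisymm (by simpa using h1) h2
    simp [saaDensity, this]
  have hfun : ∀ t ∈ Ici (0 : ℝ), ENNReal.ofReal (saaDensity q n (cdf' (bernoulliAt0 p) t)) =
      (Iio 1).indicator (fun _ => ENNReal.ofReal (saaDensity q n p)) t := by
    intro t ht
    rw [cdf'_bernoulliAt0 hp ht]
    by_cases h : t < 1 <;> simp [h, hone]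
  rw [integral_expLoss_saa hq hn (bernoulliAt0_Iio p) (integrable_bernoulliAt0 p _),
    setLIntegral_congr_fun measurableSet_Ici hfun, lintegral_indicator_const measurableSet_Iio,
    Measure.restrict_apply measurableSet_Iio, Iio_inter_Ici, Real.volume_Ico]
  simpa using saaDensity_nonneg hq n ⟨hp.1.le, hp.2.le⟩

lemma optDec_bernoulliAt0_of_lt {q : ℝ} (hq : q ∈ Ioo (0 : ℝ) 1) (hp : p ∈ Ioo (0 : ℝ) q) :
    optDec q (bernoulliAt0 p) = 1 := by
  have hp' : p ∈ Ioo (0 : ℝ) 1 := ⟨hp.1, hp.2.trans hq.2⟩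
  have := isProbabilityMeasure_bernoulliAt0 hp'
  have h0 := optDec_nonneg q (bernoulliAt0 p)
  refine le_antisymm ((optDec_le_iff hq.2 _ zero_le_one).2 ?_) (not_lt.1 fun h => ?_)
  · simpa [cdf'_bernoulliAt0 hp' zero_le_one] using hq.2.le
  · have h2 := (optDec_le_iff hq.2 _ h0).1 le_rfl
    rw [cdf'_bernoulliAt0 hp' h0, if_pos h] at h2
    exact absurd hp.2 (not_lt.2 h2)

lemma optDec_bernoulliAt0_of_le {q : ℝ} (hq : q ∈ Ioo (0 : ℝ) 1) (hp : p ∈ Ico q 1) :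
    optDec q (bernoulliAt0 p) = 0 := by
  have hp' : p ∈ Ioo (0 : ℝ) 1 := ⟨hq.1.trans_le hp.1, hp.2⟩
  have := isProbabilityMeasure_bernoulliAt0 hp'
  refine le_antisymm ((optDec_le_iff hq.2 _ le_rfl).2 ?_) (optDec_nonneg q _)
  simpa [cdf'_bernoulliAt0 hp' le_rfl] using hp.1

lemma expMultRegret_bernoulliAt0_of_lt {q : ℝ} (hq : q ∈ Ioo (0 : ℝ) 1) {n : ℕ} (hn : 1 ≤ n)
    (hp : p ∈ Ioo (0 : ℝ) q) :
    expMultRegret q n (bernoulliAt0 p) = (q - p) / ((1 - q) * p) * binomPrGe n p q := by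
  have hp' : p ∈ Ioo (0 : ℝ) 1 := ⟨hp.1, hp.2.trans hq.2⟩
  have h1 : 1 - q ≠ 0 := (sub_pos.2 hq.2).ne'
  have h2 : p ≠ 0 := hp.1.ne'
  have hL : expLoss q (bernoulliAt0 p) 1 = (1 - q) * p := by
    rw [expLoss_bernoulliAt0 hp']
    norm_num [nvLoss]
    ring
  rw [expMultRegret, integral_expLoss_saa_bernoulliAt0 hq hn hp',
    optDec_bernoulliAt0_of_lt hq hp, hL, saaDensity,
    eq_sub_of_add_eq' (binomPrGe_add_binomPrLt n p q)]
  field_simp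
  ring

lemma expMultRegret_bernoulliAt0_of_le {q : ℝ} (hq : q ∈ Ioo (0 : ℝ) 1) {n : ℕ} (hn : 1 ≤ n)
    (hp : p ∈ Ico q 1) :
    expMultRegret q n (bernoulliAt0 p) = (p - q) / (q * (1 - p)) * binomPrLt n p q := by
  have hp' : p ∈ Ioo (0 : ℝ) 1 := ⟨hq.1.trans_le hp.1, hp.2⟩
  have h1 : 1 - p ≠ 0 := (sub_pos.2 hp.2).ne'
  have h2 : q ≠ 0 := hq.1.ne'
  have hL : expLoss q (bernoulliAt0 p) 0 = q * (1 - p) := by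
    rw [expLoss_bernoulliAt0 hp']
    norm_num [nvLoss]
    ring
  rw [expMultRegret, integral_expLoss_saa_bernoulliAt0 hq hn hp',
    optDec_bernoulliAt0_of_le hq hp, hL, saaDensity,
    eq_sub_of_add_eq (binomPrGe_add_binomPrLt n p q)]
  field_simp
  ring

end Bernoulli

section Suprema

lemma bddAbove_low {q : ℝ} (hq : q ∈ Ioo (0 : ℝ) 1) (n : ℕ) :
    BddAbove {r : ℝ | ∃ p ∈ Ioo (0:ℝ) q, r = (q-p)/((1-q)*p) * binomPrGe n p q} := by
  refine ⟨2 ^ n / (1 - q), ?_⟩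
  rintro r ⟨p, hp, rfl⟩
  have h1 := sub_pos.2 hq.2
  have h2 := hp.1
  have h3 := sub_pos.2 hp.2
  have hb := binomPrGe_le hq.1 n (p := p) ⟨hp.1.le, (hp.2.trans hq.2).le⟩
  have hpow : (0 : ℝ) < 2 ^ n := by positivity
  calc (q - p) / ((1 - q) * p) * binomPrGe n p q
      ≤ (q - p) / ((1 - q) * p) * (2 ^ n * p) := by gcongr
    _ = (q - p) * 2 ^ n / (1 - q) := by field_simp
    _ ≤ 2 ^ n / (1 - q) := by
      gcongr
      nlinarith [hq.2]

lemma bddAbove_high {q : ℝ} (hq : q ∈ Ioo (0 : ℝ) 1) {n : ℕ} (hn : 1 ≤ n) :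
    BddAbove {r : ℝ | ∃ p ∈ Ico q (1:ℝ), r = (p-q)/(q*(1-p)) * binomPrLt n p q} := by
  refine ⟨2 ^ n / q, ?_⟩
  rintro r ⟨p, hp, rfl⟩
  have h1 := hq.1
  have h2 := sub_pos.2 hp.2
  have h3 := sub_nonneg.2 hp.1
  have hb := binomPrLt_le hq.2 hn (p := p) ⟨hq.1.le.trans hp.1, hp.2.le⟩
  have hpow : (0 : ℝ) < 2 ^ n := by positivity
  calc (p - q) / (q * (1 - p)) * binomPrLt n p q
      ≤ (p - q) / (q * (1 - p)) * (2 ^ n * (1 - p)) := by gcongr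
    _ = (p - q) * 2 ^ n / q := by field_simp
    _ ≤ 2 ^ n / q := by
      gcongr
      nlinarith [hp.2]

end Suprema

/-- The supremum over all distributions on `[0,∞)` with finite mean of the
expected multiplicative regret of SAA equals
`max{sup_{p∈(0,q)} ((q−p)/((1−q)p))·Pr[Bin(n,p)/n ≥ q],
     sup_{p∈[q,1)} ((p−q)/(q(1−p)))·Pr[Bin(n,p)/n < q]}`,
and the supremum restricted to Bernoulli demand distributions attains the same value. -/
theorem saa_worst_case_expected_multiplicative_regret
    (q : ℝ) (hq : q ∈ Ioo (0:ℝ) 1) (n : ℕ) (hn : 1 ≤ n) :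
    sSup {r : ℝ | ∃ μ : Measure ℝ, IsProbabilityMeasure μ ∧ μ (Iio 0) = 0 ∧
          Integrable (fun z => z) μ ∧ r = expMultRegret q n μ}
      = max (sSup {r : ℝ | ∃ p ∈ Ioo (0:ℝ) q, r = (q-p)/((1-q)*p) * binomPrGe n p q})
            (sSup {r : ℝ | ∃ p ∈ Ico q (1:ℝ), r = (p-q)/(q*(1-p)) * binomPrLt n p q}) ∧
    sSup {r : ℝ | ∃ p ∈ Ioo (0:ℝ) 1, r = expMultRegret q n (bernoulliAt0 p)}
      = max (sSup {r : ℝ | ∃ p ∈ Ioo (0:ℝ) q, r = (q-p)/((1-q)*p) * binomPrGe n p q})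
            (sSup {r : ℝ | ∃ p ∈ Ico q (1:ℝ), r = (p-q)/(q*(1-p)) * binomPrLt n p q}) := by
  set A := {r : ℝ | ∃ p ∈ Ioo (0:ℝ) q, r = (q-p)/((1-q)*p) * binomPrGe n p q} with hA
  set B := {r : ℝ | ∃ p ∈ Ico q (1:ℝ), r = (p-q)/(q*(1-p)) * binomPrLt n p q} with hB
  have hAb : BddAbove A := bddAbove_low hq n
  have hBb : BddAbove B := bddAbove_high hq hn
  have hAne : A.Nonempty := ⟨_, q / 2, ⟨half_pos hq.1, half_lt_self hq.1⟩, rfl⟩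
  have hB0 : (0 : ℝ) ∈ B := ⟨q, ⟨le_rfl, hq.2⟩, by simp⟩
  have hbern : {r : ℝ | ∃ p ∈ Ioo (0:ℝ) 1, r = expMultRegret q n (bernoulliAt0 p)} = A ∪ B := by
    ext r
    constructor
    · rintro ⟨p, hp, rfl⟩
      rcases lt_or_ge p q with h | h
      · exact Or.inl ⟨p, ⟨hp.1, h⟩, expMultRegret_bernoulliAt0_of_lt hq hn ⟨hp.1, h⟩⟩
      · exact Or.inr ⟨p, ⟨h, hp.2⟩, expMultRegret_bernoulliAt0_of_le hq hn ⟨h, hp.2⟩⟩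
    · rintro (⟨p, hp, rfl⟩ | ⟨p, hp, rfl⟩)
      · exact ⟨p, ⟨hp.1, hp.2.trans hq.2⟩, (expMultRegret_bernoulliAt0_of_lt hq hn hp).symm⟩
      · exact ⟨p, ⟨hq.1.trans_le hp.1, hp.2⟩, (expMultRegret_bernoulliAt0_of_le hq hn hp).symm⟩
  have hsup : sSup {r : ℝ | ∃ p ∈ Ioo (0:ℝ) 1, r = expMultRegret q n (bernoulliAt0 p)} =
      max (sSup A) (sSup B) := by
    rw [hbern, csSup_union hAb hAne hBb ⟨0, hB0⟩]
  have hC : 0 ≤ max (sSup A) (sSup B) := (le_csSup hBb hB0).trans (le_max_right _ _)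
  have hupper : ∀ r ∈ {r : ℝ | ∃ μ : Measure ℝ, IsProbabilityMeasure μ ∧ μ (Iio 0) = 0 ∧
      Integrable (fun z => z) μ ∧ r = expMultRegret q n μ}, r ≤ max (sSup A) (sSup B) := by
    rintro r ⟨μ, hprob, hμ, hi, rfl⟩
    refine expMultRegret_le hq hn hC (fun p hp => ?_) (fun p hp => ?_) hμ hi
    · rcases hp.1.eq_or_lt with rfl | h0
      · have := binomPrGe_le hq.1 n (p := 0) (by simp)
        nlinarith [hq.1]
      · have hpos : 0 < (1 - q) * p := mul_pos (sub_pos.2 hq.2) h0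
        rw [← div_le_iff₀ hpos, mul_div_right_comm]
        exact (le_csSup hAb ⟨p, ⟨h0, hp.2⟩, rfl⟩).trans (le_max_left _ _)
    · rcases hp.2.eq_or_lt with rfl | h1
      · have := binomPrLt_le hq.2 hn (p := 1) (by simp)
        nlinarith [hq.2]
      · have hpos : 0 < q * (1 - p) := mul_pos hq.1 (sub_pos.2 h1)
        rw [← div_le_iff₀ hpos, mul_div_right_comm]
        exact (le_csSup hBb ⟨p, ⟨hp.1, h1⟩, rfl⟩).trans (le_max_right _ _)
  refine ⟨le_antisymm (csSup_le ?_ hupper) ?_, hsup⟩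
  · have hh : (1 / 2 : ℝ) ∈ Ioo (0 : ℝ) 1 := by norm_num
    exact ⟨_, bernoulliAt0 (1 / 2), isProbabilityMeasure_bernoulliAt0 hh, bernoulliAt0_Iio _,
      integrable_bernoulliAt0 _ _, rfl⟩
  · rw [← hsup]
    refine csSup_le_csSup ⟨_, hupper⟩ ?_ ?_
    · rw [hbern]
      exact ⟨0, Or.inr hB0⟩
    · rintro r ⟨p, hp, rfl⟩
      exact ⟨bernoulliAt0 p, isProbabilityMeasure_bernoulliAt0 hp, bernoulliAt0_Iio _,
        integrable_bernoulliAt0 _ _, rfl⟩
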